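/- arXiv:1812.05360 — 2 statements merged into one kernel-verified Lean document; each statement's English description precedes it below -/
import Mathlib

section
/- Let a, b, c, n ∈ ℝ and ε > 0, and let δ_ε(t) = 1/ε for 0 ≤ t ≤ ε and δ_ε(t) = 0 otherwise. Define g_ε(t₁, t₂) = ∫_ℝ ∫_ℝ c e^{a τ₂} n e^{a τ₁} b · 1_{(0,∞)}(τ₁) 1_{(0,∞)}(τ₂) · δ_ε(t₂ − τ₂) δ_ε(t₁ − τ₂ − τ₁) dτ₂ dτ₁. Then for all s₁, s₂ ∈ ℂ with Re(s₁) > a, Re(s₁ + s₂) > a, s₁ ≠ 0 and s₂ ≠ 0: ∫₀^∞ ∫₀^∞ g_ε(t₁, t₂) e^{−s₁ t₁ − s₂ t₂} dt₂ dt₁ = c·n·b · (s₁ + s₂ − a)^{−1} (s₁ − a)^{−1} · ((1 − e^{−s₁ ε})/(s₁ ε)) · ((1 − e^{−s₂ ε})/(s₂ ε)). -/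
open MeasureTheory Set

/-- The nascent delta function of amplitude `1/ε` and duration `ε`. -/
noncomputable def nascentDelta (ε t : ℝ) : ℝ := if 0 ≤ t ∧ t ≤ ε then ε⁻¹ else 0

/-- A product `X τ * Y (t - L τ)`, with `X` and `Y` integrable, is integrable in `(τ, t)`. -/
lemma integrable_mul_comp_sub_shift {E : Type*} [AddCommGroup E] [MeasurableSpace E]
    [MeasurableAdd₂ E] [MeasurableSub₂ E] {μ : Measure E} [SFinite μ] [μ.IsAddRightInvariant]
    {X Y : E → ℂ} {L : E → E} (hL : Measurable L) (hX : Integrable X μ) (hY : Integrable Y μ) :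
    Integrable (fun p : E × E => X p.1 * Y (p.2 - L p.1)) (μ.prod μ) := by
  have hmp : MeasurePreserving (fun p : E × E => (p.1, p.2 - L p.1)) (μ.prod μ) (μ.prod μ) :=
    (MeasurePreserving.id μ).skew_product (g := fun x y => y - L x)
      (measurable_snd.sub (hL.comp measurable_fst))
      (Filter.Eventually.of_forall fun x => map_sub_right_eq_self μ (L x))
  exact hmp.integrable_comp_of_integrable (hX.mul_prod hY)

/-- The iterated integral of a shifted product `X τ * Y (t - L τ)` over the plane factors. -/
lemma integral_mul_comp_sub_shift {X Y : ℝ × ℝ → ℂ} {L : ℝ × ℝ → ℝ × ℝ} (hL : Measurable L)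
    (hX : Integrable X) (hY : Integrable Y) :
    ∫ t₁ : ℝ, ∫ t₂ : ℝ, ∫ τ₁ : ℝ, ∫ τ₂ : ℝ, X (τ₁, τ₂) * Y ((t₁, t₂) - L (τ₁, τ₂)) =
      (∫ τ, X τ) * ∫ t, Y t := by
  have hP := integrable_mul_comp_sub_shift hL hX hY
  have hae : (fun t : ℝ × ℝ => ∫ τ : ℝ × ℝ, X τ * Y (t - L τ)) =ᵐ[volume]
      fun t => ∫ τ₁ : ℝ, ∫ τ₂ : ℝ, X (τ₁, τ₂) * Y (t - L (τ₁, τ₂)) := by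
    filter_upwards [hP.prod_left_ae] with t ht
    exact integral_prod _ ht
  have hQ := hP.integral_prod_right.congr hae
  calc _ = ∫ t : ℝ × ℝ, ∫ τ₁ : ℝ, ∫ τ₂ : ℝ, X (τ₁, τ₂) * Y (t - L (τ₁, τ₂)) :=
        (integral_prod _ hQ).symm
    _ = ∫ t : ℝ × ℝ, ∫ τ : ℝ × ℝ, X τ * Y (t - L τ) := (integral_congr_ae hae).symm
    _ = ∫ τ : ℝ × ℝ, ∫ t : ℝ × ℝ, X τ * Y (t - L τ) := (integral_integral_swap hP).symm
    _ = _ := by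
      simp_rw [integral_const_mul, integral_sub_right_eq_self Y, integral_mul_const]

/-- The one-sided exponential `τ ↦ exp (z τ)`, supported on the positive reals. -/
noncomputable def causalExp (z : ℂ) : ℝ → ℂ :=
  (Ioi (0 : ℝ)).indicator fun τ => Complex.exp (z * τ)

lemma integrable_causalExp {z : ℂ} (hz : z.re < 0) : Integrable (causalExp z) :=
  (integrable_indicator_iff measurableSet_Ioi).2 (integrableOn_exp_mul_complex_Ioi hz 0)

lemma integral_causalExp {z : ℂ} (hz : z.re < 0) : ∫ τ, causalExp z τ = (-z)⁻¹ := by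
  rw [causalExp, integral_indicator measurableSet_Ioi, integral_exp_mul_complex_Ioi hz 0]
  simp [neg_div, inv_neg]

lemma nascentDelta_mul_exp_eq_indicator (ε : ℝ) (s : ℂ) :
    (fun t : ℝ => (nascentDelta ε t : ℂ) * Complex.exp (-(s * t))) =
      (Icc 0 ε).indicator fun t : ℝ => (ε : ℂ)⁻¹ * Complex.exp (-s * t) := by
  ext t
  by_cases h : 0 ≤ t ∧ t ≤ ε <;> simp [nascentDelta, indicator, h]

lemma integrable_nascentDelta_mul_exp (ε : ℝ) (s : ℂ) :
    Integrable fun t : ℝ => (nascentDelta ε t : ℂ) * Complex.exp (-(s * t)) := by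
  rw [nascentDelta_mul_exp_eq_indicator, integrable_indicator_iff measurableSet_Icc]
  exact Continuous.integrableOn_Icc (by fun_prop)

lemma integral_nascentDelta_mul_exp {ε : ℝ} (hε : 0 < ε) {s : ℂ} (hs : s ≠ 0) :
    ∫ t : ℝ, (nascentDelta ε t : ℂ) * Complex.exp (-(s * t)) =
      (1 - Complex.exp (-(s * ε))) / (s * ε) := by
  have hε' : (ε : ℂ) ≠ 0 := by exact_mod_cast hε.ne'
  rw [nascentDelta_mul_exp_eq_indicator, integral_indicator measurableSet_Icc,
    integral_Icc_eq_integral_Ioc, ← intervalIntegral.integral_of_le hε.le,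
    intervalIntegral.integral_const_mul, integral_exp_mul_complex (neg_ne_zero.2 hs)]
  simp only [neg_mul, Complex.ofReal_zero, mul_zero, Complex.exp_zero]
  field_simp
  ring

theorem stmt17 (a b c n ε : ℝ) (hε : 0 < ε)
    (g : ℝ → ℝ → ℝ)
    (hg : ∀ t₁ t₂ : ℝ, g t₁ t₂ =
      ∫ τ₁ : ℝ, ∫ τ₂ : ℝ,
        c * Real.exp (a * τ₂) * n * Real.exp (a * τ₁) * b *
          (Ioi (0 : ℝ)).indicator (fun _ => (1 : ℝ)) τ₁ *
          (Ioi (0 : ℝ)).indicator (fun _ => (1 : ℝ)) τ₂ *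
          nascentDelta ε (t₂ - τ₂) * nascentDelta ε (t₁ - τ₂ - τ₁))
    (s₁ s₂ : ℂ) (h₁ : a < s₁.re) (h₁₂ : a < (s₁ + s₂).re)
    (hs₁ : s₁ ≠ 0) (hs₂ : s₂ ≠ 0) :
    ∫ t₁ : ℝ in Ioi 0, ∫ t₂ : ℝ in Ioi 0,
        (g t₁ t₂ : ℂ) * Complex.exp (-(s₁ * t₁) - s₂ * t₂) =
      (c * n * b : ℝ) * (s₁ + s₂ - a)⁻¹ * (s₁ - a)⁻¹ *
        ((1 - Complex.exp (-(s₁ * ε))) / (s₁ * ε)) *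
        ((1 - Complex.exp (-(s₂ * ε))) / (s₂ * ε)) := by 
  set K : ℂ := ((c * n * b : ℝ) : ℂ) with hK
  let X : ℝ × ℝ → ℂ := fun τ => K * (causalExp (a - s₁) τ.1 * causalExp (a - s₁ - s₂) τ.2)
  let φ : ℂ → ℝ → ℂ := fun s t => (nascentDelta ε t : ℂ) * Complex.exp (-(s * t))
  let Y : ℝ × ℝ → ℂ := fun t => φ s₁ t.1 * φ s₂ t.2
  let L : ℝ × ℝ → ℝ × ℝ := fun τ => (τ.1 + τ.2, τ.2)
  have hz₁ : ((a : ℂ) - s₁).re < 0 := by simpa using h₁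
  have hz₂ : ((a : ℂ) - s₁ - s₂).re < 0 := by
    simp only [Complex.sub_re, Complex.ofReal_re, Complex.add_re] at h₁₂ ⊢
    linarith
  have hX : Integrable X :=
    ((integrable_causalExp hz₁).mul_prod (integrable_causalExp hz₂)).const_mul K
  have hY : Integrable Y :=
    (integrable_nascentDelta_mul_exp ε s₁).mul_prod (integrable_nascentDelta_mul_exp ε s₂)
  have hG : ∀ t₁ t₂ : ℝ, (g t₁ t₂ : ℂ) * Complex.exp (-(s₁ * t₁) - s₂ * t₂) =
      ∫ τ₁ : ℝ, ∫ τ₂ : ℝ, X (τ₁, τ₂) * Y ((t₁, t₂) - L (τ₁, τ₂)) := by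
    intro t₁ t₂
    rw [hg, ← integral_complex_ofReal, ← integral_mul_const]
    refine integral_congr_ae (.of_forall fun τ₁ => ?_)
    dsimp only
    rw [← integral_complex_ofReal, ← integral_mul_const]
    refine integral_congr_ae (.of_forall fun τ₂ => ?_)
    by_cases hτ₁ : 0 < τ₁
    swap
    · simp [X, causalExp, hτ₁]
    by_cases hτ₂ : 0 < τ₂
    swap
    · simp [X, causalExp, hτ₂]
    have hexp : Complex.exp (-(s₁ * t₁) - s₂ * t₂) * (Complex.exp (a * τ₂) *
        Complex.exp (a * τ₁)) = Complex.exp ((a - s₁) * τ₁) * Complex.exp ((a - s₁ - s₂) * τ₂) *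
        (Complex.exp (-(s₁ * (t₁ - (τ₁ + τ₂)))) * Complex.exp (-(s₂ * (t₂ - τ₂)))) := by
      simp only [← Complex.exp_add]
      ring_nf
    have hsub : t₁ - τ₂ - τ₁ = t₁ - (τ₁ + τ₂) := by ring
    simp only [X, Y, L, φ, hK, causalExp, indicator, mem_Ioi, hτ₁, hτ₂, if_true, Prod.fst_sub,
      Prod.snd_sub, hsub]
    push_cast
    linear_combination (c * n * b * nascentDelta ε (t₂ - τ₂) *
      nascentDelta ε (t₁ - (τ₁ + τ₂)) : ℂ) * hexp
  have hzero : ∀ t₁ t₂ : ℝ, ¬ (0 < t₁ ∧ 0 < t₂) → g t₁ t₂ = 0 := by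
    intro t₁ t₂ ht
    rw [hg]
    refine integral_eq_zero_of_ae (.of_forall fun τ₁ => integral_eq_zero_of_ae
      (.of_forall fun τ₂ => ?_))
    by_contra hne
    simp only [Pi.zero_apply, mul_eq_zero, not_or, indicator_apply_eq_zero, nascentDelta,
      mem_Ioi, ite_eq_right_iff, Classical.not_imp] at hne
    obtain ⟨⟨⟨⟨_, hτ₁, _⟩, hτ₂, _⟩, h₂, _⟩, h₁, _⟩ := hne
    exact ht ⟨by linarith [h₁.1], by linarith [h₂.1]⟩
  calc _ = ∫ t₁ : ℝ, ∫ t₂ : ℝ, (g t₁ t₂ : ℂ) * Complex.exp (-(s₁ * t₁) - s₂ * t₂) := by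
        rw [setIntegral_eq_integral_of_forall_compl_eq_zero]
        · refine integral_congr_ae (.of_forall fun t₁ => ?_)
          refine setIntegral_eq_integral_of_forall_compl_eq_zero fun t₂ ht₂ => ?_
          rw [hzero t₁ t₂ fun h => ht₂ h.2, Complex.ofReal_zero, zero_mul]
        · intro t₁ ht₁
          simp [hzero t₁ _ fun h => ht₁ h.1]
    _ = (∫ τ, X τ) * ∫ t, Y t := by
        simp_rw [hG]
        exact integral_mul_comp_sub_shift (by fun_prop) hX hY
    _ = _ := by
        have hXint : ∫ τ, X τ = K * ((s₁ - a)⁻¹ * (s₁ + s₂ - a)⁻¹) := by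
          rw [integral_const_mul, Measure.volume_eq_prod, integral_prod_mul,
            integral_causalExp hz₁, integral_causalExp hz₂]
          congr 3 <;> ring
        have hYint : ∫ t, Y t = (1 - Complex.exp (-(s₁ * ε))) / (s₁ * ε) *
            ((1 - Complex.exp (-(s₂ * ε))) / (s₂ * ε)) := by
          rw [Measure.volume_eq_prod, integral_prod_mul, integral_nascentDelta_mul_exp hε hs₁,
            integral_nascentDelta_mul_exp hε hs₂]
        rw [hXint, hYint]
        ring
end

section
/- Let a, b, c, n ∈ ℝ, and for ε > 0 let δ_ε(t) = 1/ε for 0 ≤ t ≤ ε and δ_ε(t) = 0 otherwise, and define g_ε(t₁, t₂) = ∫_ℝ ∫_ℝ c e^{a τ₂} n e^{a τ₁} b · 1_{(0,∞)}(τ₁) 1_{(0,∞)}(τ₂) · δ_ε(t₂ − τ₂) δ_ε(t₁ − τ₂ − τ₁) dτ₂ dτ₁. Then for every t > 0, g_ε(t, t) converges to (1/2) c e^{a t} n b as ε → 0⁺. -/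
open MeasureTheory Set Filter
open scoped Topology

/-- The two nascent deltas confine the integration variables to a triangle, on which the integral
becomes an iterated interval integral. -/
lemma integral_nascentDelta_diag (k a ε t : ℝ) (hε : 0 < ε) (hεt : ε < t) (f : ℝ → ℝ → ℝ)
    (hf : ∀ x y, f x y = k * (Real.exp (a * x) * Real.exp (a * y)) *
      (Ioi (0 : ℝ)).indicator (fun _ => (1 : ℝ)) x *
      (Ioi (0 : ℝ)).indicator (fun _ => (1 : ℝ)) y *
      nascentDelta ε (t - y) * nascentDelta ε (t - y - x)) :
    ∫ x, ∫ y, f x y =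
      k * (ε⁻¹ * ε⁻¹) * ∫ x in (0 : ℝ)..ε, Real.exp (a * x) *
        ∫ y in (t - ε)..(t - x), Real.exp (a * y) := by
  have inner (x : ℝ) : ∫ y, f x y = (Ioc 0 ε).indicator (fun x => k * (ε⁻¹ * ε⁻¹) *
      (Real.exp (a * x) * ∫ y in (t - ε)..(t - x), Real.exp (a * y))) x := by
    by_cases hx : x ∈ Ioc 0 ε
    · rw [indicator_of_mem hx, intervalIntegral.integral_of_le (by linarith [hx.2]),
        ← integral_Icc_eq_integral_Ioc, ← mul_assoc, ← integral_const_mul,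
        ← integral_indicator measurableSet_Icc]
      congr 1
      funext y
      rw [hf, indicator_of_mem (show x ∈ Ioi (0 : ℝ) from hx.1)]
      by_cases hy : y ∈ Icc (t - ε) (t - x)
      · have h1 : 0 ≤ t - y ∧ t - y ≤ ε := ⟨by linarith [hy.2, hx.1], by linarith [hy.1]⟩
        have h2 : 0 ≤ t - y - x ∧ t - y - x ≤ ε := ⟨by linarith [hy.2], by linarith [hy.1, hx.1]⟩
        have h3 : y ∈ Ioi (0 : ℝ) := by
          rw [mem_Ioi]
          linarith [hy.1]
        rw [indicator_of_mem hy, indicator_of_mem h3, nascentDelta, nascentDelta, if_pos h1,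
          if_pos h2]
        ring
      · rw [indicator_of_notMem hy]
        by_cases h1 : 0 ≤ t - y ∧ t - y ≤ ε
        · have h2 : ¬ (0 ≤ t - y - x ∧ t - y - x ≤ ε) := fun h =>
            hy ⟨by linarith [h1.2], by linarith [h.1]⟩
          simp [show nascentDelta ε (t - y - x) = 0 from if_neg h2]
        · simp [show nascentDelta ε (t - y) = 0 from if_neg h1]
    · rw [indicator_of_notMem hx]
      refine integral_eq_zero_of_ae (Eventually.of_forall fun y => ?_)
      change f x y = 0
      rw [hf]
      by_cases h0 : x ∈ Ioi (0 : ℝ)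
      · by_cases h1 : 0 ≤ t - y ∧ t - y ≤ ε
        · have h2 : ¬ (0 ≤ t - y - x ∧ t - y - x ≤ ε) := fun h =>
            hx ⟨h0, by linarith [h1.2, h.1]⟩
          simp [show nascentDelta ε (t - y - x) = 0 from if_neg h2]
        · simp [show nascentDelta ε (t - y) = 0 from if_neg h1]
      · simp [indicator_of_notMem h0]
  simp_rw [inner]
  rw [integral_indicator measurableSet_Ioc, integral_const_mul,
    intervalIntegral.integral_of_le hε.le]

lemma integral_exp_mul_triangle (a ε t : ℝ) (ha : a ≠ 0) :
    ∫ x in (0 : ℝ)..ε, Real.exp (a * x) * ∫ y in (t - ε)..(t - x), Real.exp (a * y) =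
      Real.exp (a * t) * ((Real.exp (-a * ε) - 1 - -a * ε) / a ^ 2) := by
  have inner (u v : ℝ) :
      ∫ y in u..v, Real.exp (a * y) = a⁻¹ * (Real.exp (a * v) - Real.exp (a * u)) := by
    rw [intervalIntegral.integral_comp_mul_left (fun y => Real.exp y) ha, integral_exp,
      smul_eq_mul]
  have outer (x : ℝ) : Real.exp (a * x) * ∫ y in (t - ε)..(t - x), Real.exp (a * y) =
      a⁻¹ * Real.exp (a * t) * (1 - Real.exp (-a * ε) * Real.exp (a * x)) := by
    have h1 : Real.exp (a * (t - x)) * Real.exp (a * x) = Real.exp (a * t) := by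
      rw [← Real.exp_add]
      ring_nf
    have h2 : Real.exp (a * (t - ε)) = Real.exp (a * t) * Real.exp (-a * ε) := by
      rw [← Real.exp_add]
      ring_nf
    rw [inner, h2]
    linear_combination a⁻¹ * h1
  have h3 : Real.exp (-a * ε) * Real.exp (a * ε) = 1 := by
    rw [← Real.exp_add]
    simp
  simp_rw [outer]
  rw [intervalIntegral.integral_const_mul, intervalIntegral.integral_sub (by simp)
    (Continuous.intervalIntegrable (by fun_prop) _ _), intervalIntegral.integral_const_mul, inner]
  simp only [intervalIntegral.integral_const, smul_eq_mul, mul_zero, Real.exp_zero]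
  rw [neg_mul] at h3 ⊢
  field_simp
  linear_combination -h3

lemma tendsto_exp_sub_one_sub_self_div_sq :
    Tendsto (fun x : ℝ => (Real.exp x - 1 - x) / x ^ 2) (𝓝[≠] 0) (𝓝 (1 / 2)) := by
  rw [tendsto_iff_norm_sub_tendsto_zero]
  have hlim : Tendsto (fun x : ℝ => |x|) (𝓝[≠] 0) (𝓝 0) := by
    have h : Tendsto (fun x : ℝ => |x|) (𝓝 0) (𝓝 |0|) := continuous_abs.tendsto 0
    rw [abs_zero] at h
    exact h.mono_left nhdsWithin_le_nhds
  refine squeeze_zero' (Eventually.of_forall fun _ => norm_nonneg _) ?_ hlim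
  filter_upwards [self_mem_nhdsWithin, hlim.eventually (ge_mem_nhds zero_lt_one)] with x hx hx1
  have hx0 : x ≠ 0 := hx
  have hb := Real.exp_bound hx1 (n := 3) (by norm_num)
  norm_num [Finset.sum_range_succ, Nat.factorial] at hb
  have heq : (Real.exp x - 1 - x) / x ^ 2 - 1 / 2 =
      (Real.exp x - (1 + x + x ^ 2 / 2)) / x ^ 2 := by
    field_simp
    ring
  rw [Real.norm_eq_abs, heq, abs_div, abs_of_nonneg (sq_nonneg x), div_le_iff₀ (by positivity)]
  have hcube : 0 ≤ |x| ^ 3 := by positivity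
  have hmul : |x| * x ^ 2 = |x| ^ 3 := by
    rw [← sq_abs x]
    ring
  linarith

theorem stmt19 (a b c n : ℝ)
    (g : ℝ → ℝ → ℝ → ℝ)
    (hg : ∀ ε t₁ t₂ : ℝ, g ε t₁ t₂ =
      ∫ τ₁ : ℝ, ∫ τ₂ : ℝ,
        c * Real.exp (a * τ₂) * n * Real.exp (a * τ₁) * b *
          (Ioi (0 : ℝ)).indicator (fun _ => (1 : ℝ)) τ₁ *
          (Ioi (0 : ℝ)).indicator (fun _ => (1 : ℝ)) τ₂ *
          nascentDelta ε (t₂ - τ₂) * nascentDelta ε (t₁ - τ₂ - τ₁))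
    (t : ℝ) (ht : 0 < t) :
    Tendsto (fun ε : ℝ => g ε t t) (𝓝[>] 0)
      (𝓝 ((1 / 2) * c * Real.exp (a * t) * n * b)) := by
  have hev : ∀ᶠ ε in 𝓝[>] (0 : ℝ), 0 < ε ∧ g ε t t = c * n * b * (ε⁻¹ * ε⁻¹) *
      ∫ x in (0 : ℝ)..ε, Real.exp (a * x) * ∫ y in (t - ε)..(t - x), Real.exp (a * y) := by
    filter_upwards [Ioo_mem_nhdsGT ht] with ε hε
    refine ⟨hε.1, ?_⟩
    rw [hg]
    exact integral_nascentDelta_diag _ a ε t hε.1 hε.2 _ fun x y => by ring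
  by_cases ha : a = 0
  · subst ha
    refine tendsto_const_nhds.congr' ?_
    filter_upwards [hev] with ε hε
    have hε0 : ε ≠ 0 := hε.1.ne'
    rw [hε.2]
    have hlen (x : ℝ) : t - x - (t - ε) = ε - x := by ring
    simp only [zero_mul, Real.exp_zero, intervalIntegral.integral_const, smul_eq_mul, mul_one,
      one_mul, hlen]
    rw [intervalIntegral.integral_sub (by simp) (by simp)]
    simp only [intervalIntegral.integral_const, smul_eq_mul, integral_id]
    field_simp
    ring
  · have hscale : Tendsto (fun ε : ℝ => -a * ε) (𝓝[>] 0) (𝓝[≠] 0) := by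
      refine tendsto_nhdsWithin_iff.mpr ⟨?_, ?_⟩
      · have h : Tendsto (fun ε : ℝ => -a * ε) (𝓝 0) (𝓝 (-a * 0)) :=
          (continuous_const_mul (-a)).tendsto 0
        rw [mul_zero] at h
        exact h.mono_left nhdsWithin_le_nhds
      · filter_upwards [self_mem_nhdsWithin] with ε hε
        exact mul_ne_zero (neg_ne_zero.mpr ha) (ne_of_gt hε)
    have hlim := (tendsto_exp_sub_one_sub_self_div_sq.comp hscale).const_mul
      (c * Real.exp (a * t) * n * b)
    rw [show (1 / 2) * c * Real.exp (a * t) * n * b =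
      c * Real.exp (a * t) * n * b * (1 / 2) by ring]
    refine hlim.congr' ?_
    filter_upwards [hev] with ε hε
    have hε0 : ε ≠ 0 := hε.1.ne'
    rw [hε.2, integral_exp_mul_triangle a ε t ha, Function.comp_apply]
    field_simp
end
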